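/- There exists a hedonic diversity game with 10 agents (4 red and 6 blue) in which all agents have naturally single-peaked preferences (with indifferences allowed), and an initial partition, such that no partition reachable from the initial partition by a finite sequence of IS deviations is individually stable; hence the dynamics of IS deviations can never reach an individually stable partition, whatever the chosen path of deviations. -/

import Mathlib

/-- A partition of the agent set `A`, encoded by the map sending each agent to
the coalition containing it. -/
def IsPartition {A : Type*} [DecidableEq A] (π : A → Finset A) : Prop :=
  (∀ i, i ∈ π i) ∧ ∀ i j, i ∈ π j → π i = π j

/-- Strict part of a weak preference relation `r`. -/
def StrictPref {α : Type*} (r : α → α → Prop) (x y : α) : Prop :=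
  r x y ∧ ¬ r y x

/-- `π'` is obtained from `π` by an IS deviation of agent `i`, where
`wp j C D` means that agent `j` weakly prefers coalition `C` to coalition `D`. -/
def IsISDeviation {A : Type*} [DecidableEq A]
    (wp : A → Finset A → Finset A → Prop) (π π' : A → Finset A) (i : A) : Prop :=
  π' i ≠ π i ∧
  (∀ j, j ≠ i → (π' j).erase i = (π j).erase i) ∧
  StrictPref (wp i) (π' i) (π i) ∧
  ∀ j ∈ (π' i).erase i, wp j (π' j) (π j)

/-- One step of the dynamics of IS deviations between partitions. -/
def ISStep {A : Type*} [DecidableEq A]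
    (wp : A → Finset A → Finset A → Prop) (π π' : A → Finset A) : Prop :=
  IsPartition π ∧ IsPartition π' ∧ ∃ i, IsISDeviation wp π π' i

/-- A partition is individually stable if no IS deviation from it is possible. -/
def IndividuallyStable {A : Type*} [DecidableEq A]
    (wp : A → Finset A → Finset A → Prop) (π : A → Finset A) : Prop :=
  IsPartition π ∧ ∀ π' : A → Finset A, ¬ ISStep wp π π'

/-- `r` is a weak order (total preorder) on the set `S`. -/
def WeakOrderOn {α : Type*} (r : α → α → Prop) (S : Set α) : Prop :=
  (∀ x ∈ S, ∀ y ∈ S, r x y ∨ r y x) ∧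
  ∀ x ∈ S, ∀ y ∈ S, ∀ z ∈ S, r x y → r y z → r x z

/-- `r` is antisymmetric on `S`, i.e. the preferences are strict. -/
def StrictPrefsOn {α : Type*} (r : α → α → Prop) (S : Set α) : Prop :=
  ∀ x ∈ S, ∀ y ∈ S, r x y → r y x → x = y

/-- `r` is (naturally) single-peaked on `S` with respect to the natural linear
order of `α`: whenever `y` lies strictly between `x` and `z`, `x ≻ y` implies `y ≿ z`. -/
def SinglePeakedOn {α : Type*} [LinearOrder α] (r : α → α → Prop) (S : Set α) : Prop :=
  ∀ x ∈ S, ∀ y ∈ S, ∀ z ∈ S,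
    ((x < y ∧ y < z) ∨ (z < y ∧ y < x)) → StrictPref r x y → r y z

/-- The fraction of red agents (members of `R`) in the coalition `C`. -/
def redRatio {A : Type*} [DecidableEq A] (R : Finset A) (C : Finset A) : ℚ :=
  ((R ∩ C).card : ℚ) / (C.card : ℚ)

/-- The set of ratios `p/q` with `0 ≤ p ≤ r` and `1 ≤ q ≤ n`. -/
def RatioSet (r n : ℕ) : Set ℚ :=
  {x : ℚ | ∃ p q : ℕ, p ≤ r ∧ 1 ≤ q ∧ q ≤ n ∧ x = (p : ℚ) / (q : ℚ)}

/-- Coalition preferences of a hedonic diversity game with red agents `R`: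
coalitions are compared by their fraction of red agents via the ratio
preferences `rp`. -/
def hdgPref {A : Type*} [DecidableEq A] (R : Finset A) (rp : A → ℚ → ℚ → Prop) :
    A → Finset A → Finset A → Prop :=
  fun i C D => rp i (redRatio R C) (redRatio R D)

/-- A coalition is homogeneous if it consists only of red agents or only of
blue agents. -/
def HomogeneousCoalition {A : Type*} [DecidableEq A] (R : Finset A) (C : Finset A) : Prop :=
  C ⊆ R ∨ ∀ a ∈ C, a ∉ R

/-- One step of the dynamics of IS deviations in a hedonic diversity game in
which the deviation satisfies solitary homogeneity: if the target coalition of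
the deviator is homogeneous, then it is a singleton. -/
def ISStepSH {A : Type*} [DecidableEq A] (R : Finset A) (rp : A → ℚ → ℚ → Prop)
    (π π' : A → Finset A) : Prop :=
  IsPartition π ∧ IsPartition π' ∧
  ∃ i, IsISDeviation (hdgPref R rp) π π' i ∧
    (HomogeneousCoalition R (π' i) → (π' i).card = 1)

/-- Lower thresholds of the agents' utilities. -/
def loThr : Fin 10 → List ℚ :=
  ![[2/7], [3/8], [2/7], [3/5], [0, 1/7], [1/7], [1/7], [1/2], [], [0]]

/-- Upper thresholds of the agents' utilities. -/
def hiThr : Fin 10 → List ℚ :=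
  ![[1], [2/3], [1/3], [1], [1/2, 3/7], [1/4], [1], [1], [], [1/3]]

/-- Number of lower thresholds passed. -/
def loU (i : Fin 10) (x : ℚ) : ℕ := (loThr i).countP (fun a => decide (a ≤ x))

/-- Number of upper thresholds not exceeded. -/
def hiU (i : Fin 10) (x : ℚ) : ℕ := (hiThr i).countP (fun a => decide (x ≤ a))

/-- Utility: minimum of a monotone and an antitone function, hence single-peaked. -/
def util (i : Fin 10) (x : ℚ) : ℕ := min (loU i x) (hiU i x)

/-- The ratio preferences of the game. -/
def rpEx (i : Fin 10) (x y : ℚ) : Prop := util i y ≤ util i x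

instance instDecRpEx (i : Fin 10) (x y : ℚ) : Decidable (rpEx i x y) :=
  inferInstanceAs (Decidable (_ ≤ _))

/-- The red agents. -/
def redEx : Finset (Fin 10) := {0, 1, 2, 3}

instance instDecWp (i : Fin 10) (C D : Finset (Fin 10)) : Decidable (hdgPref redEx rpEx i C D) :=
  instDecRpEx _ _ _

/-- The six partitions forming the cycle of IS deviations. -/
def cyc : Fin 6 → Fin 10 → Finset (Fin 10) := ![
  ![{0, 8, 9}, {1, 2, 6, 7}, {1, 2, 6, 7}, {3}, {4, 5}, {4, 5}, {1, 2, 6, 7}, {1, 2, 6, 7},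
    {0, 8, 9}, {0, 8, 9}],
  ![{0, 8, 9}, {1, 6, 7}, {2, 4, 5}, {3}, {2, 4, 5}, {2, 4, 5}, {1, 6, 7}, {1, 6, 7},
    {0, 8, 9}, {0, 8, 9}],
  ![{0, 8, 9}, {1, 5, 6, 7}, {2, 4}, {3}, {2, 4}, {1, 5, 6, 7}, {1, 5, 6, 7}, {1, 5, 6, 7},
    {0, 8, 9}, {0, 8, 9}],
  ![{0, 8, 9}, {1, 4, 5, 6, 7}, {2}, {3}, {1, 4, 5, 6, 7}, {1, 4, 5, 6, 7}, {1, 4, 5, 6, 7},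
    {1, 4, 5, 6, 7}, {0, 8, 9}, {0, 8, 9}],
  ![{0, 8, 9}, {1, 4, 5, 6}, {2, 7}, {3}, {1, 4, 5, 6}, {1, 4, 5, 6}, {1, 4, 5, 6}, {2, 7},
    {0, 8, 9}, {0, 8, 9}],
  ![{0, 8, 9}, {1, 2, 7}, {1, 2, 7}, {3}, {4, 5, 6}, {4, 5, 6}, {4, 5, 6}, {1, 2, 7},
    {0, 8, 9}, {0, 8, 9}]]

/-- Coalition of the deviator `i` after joining the coalition of `j` (`j = i`: alone). -/
def target (π : Fin 10 → Finset (Fin 10)) (i j : Fin 10) : Finset (Fin 10) :=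
  if j = i then {i} else insert i ((π j).erase i)

/-- The partition after `i` has moved into the coalition `T`. -/
def moveTo (π : Fin 10 → Finset (Fin 10)) (i : Fin 10) (T : Finset (Fin 10)) :
    Fin 10 → Finset (Fin 10) :=
  fun j => if j ∈ T then T else (π j).erase i

theorem eq_moveTo {π π' : Fin 10 → Finset (Fin 10)} {i : Fin 10} (h' : IsPartition π')
    (hd : ∀ j, j ≠ i → (π' j).erase i = (π j).erase i) :
    ∃ j, π' i = target π i j ∧ π' = moveTo π i (target π i j) := by
  have key : ∃ j, π' i = target π i j := by
    by_cases hex : ∃ j, j ≠ i ∧ j ∈ π' i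
    · obtain ⟨j, hj, hm⟩ := hex
      refine ⟨j, ?_⟩
      have e := h'.2 j i hm
      rw [target, if_neg hj, ← hd j hj, e, Finset.insert_erase (h'.1 i)]
    · refine ⟨i, ?_⟩
      push Not at hex
      rw [target, if_pos rfl]
      ext j
      rw [Finset.mem_singleton]
      constructor
      · intro hm
        by_contra hne
        exact hex j hne hm
      · rintro rfl
        exact h'.1 j
  obtain ⟨j, hj⟩ := key
  refine ⟨j, hj, ?_⟩
  rw [← hj]
  funext k
  unfold moveTo
  split_ifs with hk
  · exact h'.2 k i hk
  · have hki : k ≠ i := by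
      rintro rfl
      exact hk (h'.1 k)
    have hik : i ∉ π' k := fun hm => hk (by rw [h'.2 i k hm]; exact h'.1 k)
    rw [← hd k hki, Finset.erase_eq_of_notMem hik]

theorem cyc_partition : ∀ s, IsPartition (cyc s) := by
  unfold IsPartition
  decide +kernel

theorem cyc_closed : ∀ s i j,
    (hdgPref redEx rpEx i (target (cyc s) i j) (cyc s i) ∧
      ¬ hdgPref redEx rpEx i (cyc s i) (target (cyc s) i j)) →
    (∀ k ∈ (target (cyc s) i j).erase i,
      hdgPref redEx rpEx k (moveTo (cyc s) i (target (cyc s) i j) k) (cyc s k)) →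
    moveTo (cyc s) i (target (cyc s) i j) = cyc (s + 1) := by
  decide +kernel

theorem cyc_next : ∀ s, ∃ i, IsISDeviation (hdgPref redEx rpEx) (cyc s) (cyc (s + 1)) i := by
  unfold IsISDeviation StrictPref
  decide +kernel

theorem loU_mono (i : Fin 10) {x y : ℚ} (h : x ≤ y) : loU i x ≤ loU i y := by
  apply List.countP_mono_left
  intro a _ ha
  simp only [decide_eq_true_eq] at *
  exact ha.trans h

theorem hiU_anti (i : Fin 10) {x y : ℚ} (h : x ≤ y) : hiU i y ≤ hiU i x := by
  apply List.countP_mono_left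
  intro a _ ha
  simp only [decide_eq_true_eq] at *
  exact h.trans ha

theorem step_cyc {s : Fin 6} {π' : Fin 10 → Finset (Fin 10)}
    (h : ISStep (hdgPref redEx rpEx) (cyc s) π') : π' = cyc (s + 1) := by
  obtain ⟨-, h', i, -, hd, hs, ha⟩ := h
  obtain ⟨j, hj, hm⟩ := eq_moveTo h' hd
  rw [hm]
  apply cyc_closed s i j
  · rw [hj] at hs
    exact hs
  · intro k hk
    rw [← hm]
    rw [← hj] at hk
    exact ha k hk


/-- There exists a hedonic diversity game with 10 agents (4 red, 6 blue) with
naturally single-peaked preferences (indifferences allowed), and an initial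
partition, such that no partition reachable from it by IS deviations is
individually stable. -/
theorem hdg_natSP_never_reach_IS :
    ∃ (R : Finset (Fin 10)) (rp : Fin 10 → ℚ → ℚ → Prop),
      R.card = 4 ∧
      (∀ i, WeakOrderOn (rp i) (RatioSet R.card 10)) ∧
      (∀ i, SinglePeakedOn (rp i) (RatioSet R.card 10)) ∧
      ∃ π0 : Fin 10 → Finset (Fin 10),
        IsPartition π0 ∧
        ∀ (m : ℕ) (seq : ℕ → Fin 10 → Finset (Fin 10)),
          seq 0 = π0 →
          (∀ k < m, ISStep (hdgPref R rp) (seq k) (seq (k + 1))) →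
          ¬ IndividuallyStable (hdgPref R rp) (seq m) := by
  refine ⟨redEx, rpEx, rfl, ?_, ?_, cyc 0, cyc_partition 0, ?_⟩
  · intro i
    exact ⟨fun x _ y _ => le_total _ _, fun x _ y _ z _ h1 h2 => le_trans h2 h1⟩
  · rintro i x - y - z - hxyz ⟨-, hn⟩
    simp only [rpEx, util, not_le] at hn ⊢
    rcases hxyz with ⟨h1, h2⟩ | ⟨h1, h2⟩
    · have a := loU_mono i h1.le
      have b := hiU_anti i h2.le
      omega
    · have a := loU_mono i h1.le
      have b := hiU_anti i h2.le
      omega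
  · intro m seq h0 hstep hst
    have key : ∀ k ≤ m, ∃ s, seq k = cyc s := by
      intro k
      induction k with
      | zero => exact fun _ => ⟨0, h0⟩
      | succ k ih =>
        intro hk
        obtain ⟨s, hs⟩ := ih (by omega)
        have h := hstep k (by omega)
        rw [hs] at h
        exact ⟨s + 1, step_cyc h⟩
    obtain ⟨s, hs⟩ := key m le_rfl
    rw [hs] at hst
    exact hst.2 (cyc (s + 1)) ⟨cyc_partition s, cyc_partition (s + 1), cyc_next s⟩
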